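/- arXiv:2412.06701 — 2 statements merged into one kernel-verified Lean document; each statement's English description precedes it below -/
import Mathlib

section
/- Fix p ∈ ℝ. For a > 0 define the measures on ℝ × ℝ: 𝒦(a) := Measure.map (fun y => (a, y)) (GIG(p; a⁻¹, 1)), and for (λ, l) ∈ (0,∞)² define 𝒫(λ, l) := Measure.map (fun w => ((w + l⁻¹)²·λ, w²·l + w)) (GIG(p; 1, 1)); set 𝒬(a) := Measure.map Prod.fst (Measure.bind (𝒦(a)) 𝒫). Then for every a > 0 the intertwining relation holds: Measure.bind (𝒦(a)) 𝒫 = Measure.bind (𝒬(a)) 𝒦. -/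
open MeasureTheory

/-- Unnormalized density of the generalized inverse Gaussian distribution `GIG(p; a, b)`. -/
noncomputable def gigDensity (p a b : ℝ) (x : ℝ) : ENNReal :=
  if 0 < x then ENNReal.ofReal (x ^ (p - 1) * Real.exp (-(a * x + b / x) / 2)) else 0

/-- The (scalar) generalized inverse Gaussian distribution `GIG(p; a, b)`. -/
noncomputable def GIG (p a b : ℝ) : Measure ℝ :=
  ((volume.withDensity (gigDensity p a b)) Set.univ)⁻¹ • volume.withDensity (gigDensity p a b)

/-- The Rogers–Pitman kernel `𝒦(a) = δ_a ⊗ GIG(p; a⁻¹, 1)`. -/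
noncomputable def K (p : ℝ) (a : ℝ) : Measure (ℝ × ℝ) :=
  Measure.map (fun y => (a, y)) (GIG p a⁻¹ 1)

/-- The one-step transition kernel of the chain `(Λ, L)`:
`Λ' = (w + L⁻¹)²·Λ`, `L' = w²·L + w` with `w ~ GIG(p; 1, 1)`. -/
noncomputable def P (p : ℝ) (q : ℝ × ℝ) : Measure (ℝ × ℝ) :=
  Measure.map (fun w => ((w + q.2⁻¹) ^ 2 * q.1, w ^ 2 * q.2 + w)) (GIG p 1 1)

/-- The kernel `𝒬(a)`: first marginal of `𝒦(a)` composed with `𝒫`. -/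
noncomputable def Q (p : ℝ) (a : ℝ) : Measure ℝ :=
  Measure.map Prod.fst (Measure.bind (K p a) (P p))

open Set

lemma measurable_gigDensity (p b : ℝ) :
    Measurable fun z : ℝ × ℝ => gigDensity p z.1 b z.2 := by
  unfold gigDensity
  refine Measurable.ite (measurableSet_lt measurable_const measurable_snd) ?_ measurable_const
  fun_prop

lemma measurable_gigDensity_right (p a b : ℝ) : Measurable (gigDensity p a b) :=
  (measurable_gigDensity p b).comp (measurable_const.prodMk measurable_id)

lemma gigDensity_of_pos (p a b : ℝ) {x : ℝ} (hx : 0 < x) :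
    gigDensity p a b x =
      ENNReal.ofReal (x ^ (p - 1) * Real.exp (-(a * x + b / x) / 2)) := if_pos hx

lemma lintegral_gigDensity_mul (p a b : ℝ) (f : ℝ → ENNReal) :
    ∫⁻ x, gigDensity p a b x * f x = ∫⁻ x in Ioi 0, gigDensity p a b x * f x := by
  rw [← lintegral_indicator measurableSet_Ioi]
  refine lintegral_congr fun x => ?_
  by_cases hx : 0 < x
  · rw [indicator_of_mem (mem_Ioi.2 hx)]
  · rw [indicator_of_notMem (by simpa using hx), gigDensity, if_neg hx, zero_mul]

/-- The normalizing constant of `GIG(p; a, b)`. -/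
noncomputable def gigMass (p a b : ℝ) : ENNReal := ∫⁻ x, gigDensity p a b x

lemma gigMass_ne_zero (p a b : ℝ) : gigMass p a b ≠ 0 := by
  rw [gigMass, ← pos_iff_ne_zero, lintegral_pos_iff_support (measurable_gigDensity_right p a b)]
  refine lt_of_lt_of_le ?_ (measure_mono (s := Ioi (0 : ℝ)) fun x hx => ?_)
  · simp
  · have hx : 0 < x := hx
    rw [Function.mem_support, gigDensity_of_pos p a b hx]
    simpa using by positivity

lemma gigMass_ne_top (p : ℝ) {a b : ℝ} (ha : 0 < a) (hb : 0 < b) : gigMass p a b ≠ ⊤ := by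
  obtain ⟨N, hN⟩ := exists_nat_gt (-p)
  have hint := (integrableOn_rpow_mul_exp_neg_mul_rpow (s := p - 1 + N) (p := 1) (b := a / 2)
    (by linarith) one_pos (half_pos ha)).const_mul (N.factorial * (2 / b) ^ N)
  refine ne_top_of_le_ne_top hint.lintegral_lt_top.ne ?_
  have h := lintegral_gigDensity_mul p a b 1
  simp only [Pi.one_apply, mul_one] at h
  rw [gigMass, h]
  refine setLIntegral_mono' measurableSet_Ioi fun x hx => ?_
  have hx : 0 < x := hx
  rw [gigDensity_of_pos p a b hx]
  refine ENNReal.ofReal_le_ofReal ?_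
  have hsplit : Real.exp (-(a * x + b / x) / 2) =
      Real.exp (-(a / 2) * x) * (Real.exp (b / (2 * x)))⁻¹ := by
    rw [← Real.exp_neg, ← Real.exp_add]
    congr 1
    field_simp
    ring
  have hexp : (Real.exp (b / (2 * x)))⁻¹ ≤ N.factorial * (2 / b) ^ N * x ^ N := by
    have := Real.pow_div_factorial_le_exp (b / (2 * x)) (by positivity) N
    calc (Real.exp (b / (2 * x)))⁻¹ ≤ ((b / (2 * x)) ^ N / N.factorial)⁻¹ := by gcongr
      _ = N.factorial * (2 / b) ^ N * x ^ N := by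
        simp only [div_pow, mul_pow]
        field_simp
  rw [hsplit, Real.rpow_add hx, Real.rpow_one, Real.rpow_natCast]
  calc x ^ (p - 1) * (Real.exp (-(a / 2) * x) * (Real.exp (b / (2 * x)))⁻¹)
      ≤ x ^ (p - 1) * (Real.exp (-(a / 2) * x) * (N.factorial * (2 / b) ^ N * x ^ N)) := by
        gcongr
    _ = N.factorial * (2 / b) ^ N * (x ^ (p - 1) * x ^ N * Real.exp (-(a / 2) * x)) := by ring

lemma lintegral_GIG (p a b : ℝ) {f : ℝ → ENNReal} (hf : Measurable f) :
    ∫⁻ x, f x ∂GIG p a b = (gigMass p a b)⁻¹ * ∫⁻ x, gigDensity p a b x * f x := by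
  rw [GIG, lintegral_smul_measure, withDensity_apply _ MeasurableSet.univ, Measure.restrict_univ,
    lintegral_withDensity_eq_lintegral_mul _ (measurable_gigDensity_right p a b) hf]
  rfl

lemma lintegral_K (p a : ℝ) {f : ℝ × ℝ → ENNReal} (hf : Measurable f) :
    ∫⁻ q, f q ∂K p a = (gigMass p a⁻¹ 1)⁻¹ * ∫⁻ y, gigDensity p a⁻¹ 1 y * f (a, y) := by
  rw [K, lintegral_map hf measurable_prodMk_left]
  exact lintegral_GIG _ _ _ (hf.comp measurable_prodMk_left)

lemma lintegral_P (p : ℝ) (q : ℝ × ℝ) {f : ℝ × ℝ → ENNReal} (hf : Measurable f) :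
    ∫⁻ r, f r ∂P p q = (gigMass p 1 1)⁻¹ *
      ∫⁻ w, gigDensity p 1 1 w * f ((w + q.2⁻¹) ^ 2 * q.1, w ^ 2 * q.2 + w) := by
  have h : Measurable fun w : ℝ => ((w + q.2⁻¹) ^ 2 * q.1, w ^ 2 * q.2 + w) := by fun_prop
  rw [P, lintegral_map hf h]
  exact lintegral_GIG _ _ _ (hf.comp h)

lemma measurable_gigMass (p b : ℝ) : Measurable fun a => gigMass p a b :=
  (measurable_gigDensity p b).lintegral_prod_right'

lemma measurable_K (p : ℝ) : Measurable (K p) := by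
  refine Measure.measurable_of_measurable_coe _ fun s hs => ?_
  have hind : Measurable (s.indicator (1 : ℝ × ℝ → ENNReal)) := measurable_one.indicator hs
  have h : ∀ a, K p a s = (gigMass p a⁻¹ 1)⁻¹ *
      ∫⁻ y, gigDensity p a⁻¹ 1 y * s.indicator 1 (a, y) := fun a => by
    rw [← lintegral_K p a hind, lintegral_indicator_one hs]
  simp_rw [h]
  refine ((measurable_gigMass p 1).comp measurable_inv).inv.mul ?_
  refine Measurable.lintegral_prod_right' (f := fun z : ℝ × ℝ =>
    gigDensity p z.1⁻¹ 1 z.2 * s.indicator 1 (z.1, z.2)) ?_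
  exact ((measurable_gigDensity p 1).comp (measurable_fst.inv.prodMk measurable_snd)).mul hind

lemma measurable_P (p : ℝ) : Measurable (P p) := by
  refine Measure.measurable_of_measurable_coe _ fun s hs => ?_
  have hind : Measurable (s.indicator (1 : ℝ × ℝ → ENNReal)) := measurable_one.indicator hs
  have h : ∀ q, P p q s = (gigMass p 1 1)⁻¹ * ∫⁻ w, gigDensity p 1 1 w *
      s.indicator 1 ((w + q.2⁻¹) ^ 2 * q.1, w ^ 2 * q.2 + w) := fun q => by
    rw [← lintegral_P p q hind, lintegral_indicator_one hs]
  simp_rw [h]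
  refine Measurable.const_mul ?_ _
  refine Measurable.lintegral_prod_right' (f := fun z : (ℝ × ℝ) × ℝ => gigDensity p 1 1 z.2 *
    s.indicator 1 ((z.2 + z.1.2⁻¹) ^ 2 * z.1.1, z.2 ^ 2 * z.1.2 + z.2)) ?_
  exact ((measurable_gigDensity_right p 1 1).comp measurable_snd).mul
    (hind.comp (by fun_prop))

lemma lintegral_Ioi_comp_inv_sub (w : ℝ) (F : ℝ → ENNReal) :
    ∫⁻ y in Ioi 0, F y = ∫⁻ s in Ioi w, ENNReal.ofReal ((s - w) ^ 2)⁻¹ * F (s - w)⁻¹ := by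
  have himg : (fun s : ℝ => (s - w)⁻¹) '' Ioi w = Ioi 0 := by
    ext y
    constructor
    · rintro ⟨s, hs, rfl⟩
      have hs : w < s := hs
      simpa using hs
    · intro hy
      exact ⟨w + y⁻¹, by simpa using hy, by simp⟩
  rw [← himg, lintegral_image_eq_lintegral_abs_deriv_mul (f' := fun s => -1 / (s - w) ^ 2)
    measurableSet_Ioi]
  · refine setLIntegral_congr_fun measurableSet_Ioi fun s hs => ?_
    simp [abs_div]
  · intro s hs
    exact (((hasDerivAt_id s).sub_const w).inv (sub_pos.2 hs).ne').hasDerivWithinAt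
  · intro s _ t _ hst
    simpa using hst

lemma lintegral_Ioo_comp_harmonic {s : ℝ} (hs : 0 < s) (F : ℝ → ENNReal) :
    ∫⁻ w in Ioo 0 s, F w =
      ∫⁻ l in Ioi 0, ENNReal.ofReal (s ^ 2 / (l + s) ^ 2) * F (l * s / (l + s)) := by
  have himg : (fun l : ℝ => l * s / (l + s)) '' Ioi 0 = Ioo 0 s := by
    ext w
    constructor
    · rintro ⟨l, hl, rfl⟩
      have hl : 0 < l := hl
      refine ⟨by positivity, ?_⟩
      rw [div_lt_iff₀ (by positivity)]
      nlinarith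
    · rintro ⟨h0, h1⟩
      have : 0 < s - w := sub_pos.2 h1
      refine ⟨w * s / (s - w), by simp only [mem_Ioi]; positivity, ?_⟩
      have h2 : w * s / (s - w) + s = s ^ 2 / (s - w) := by
        field_simp
        ring
      simp only [h2]
      field_simp
  rw [← himg, lintegral_image_eq_lintegral_abs_deriv_mul
    (f' := fun l => s ^ 2 / (l + s) ^ 2) measurableSet_Ioi]
  · refine setLIntegral_congr_fun measurableSet_Ioi fun l hl => ?_
    have : |s ^ 2 / (l + s) ^ 2| = s ^ 2 / (l + s) ^ 2 := abs_of_nonneg (by positivity)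
    simp only [this]
  · intro l hl
    have hl : 0 < l := hl
    refine ((((hasDerivAt_id' l).mul_const s).div ((hasDerivAt_id' l).add_const s)
      (by positivity)).congr_deriv ?_).hasDerivWithinAt
    ring
  · intro l hl m hm h
    have hl : 0 < l := hl
    have hm : 0 < m := hm
    rw [div_eq_div_iff (by positivity) (by positivity)] at h
    have : s ^ 2 * (l - m) = 0 := by linarith
    simpa [hs.ne', sub_eq_zero] using this

/-- Change of variables `s = w + y⁻¹`, `l = w² y + w` on the positive quadrant. -/
lemma lintegral_quadrant_comp {G : ℝ × ℝ → ENNReal} (hG : Measurable G) :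
    ∫⁻ w in Ioi 0, ∫⁻ y in Ioi 0, G (w, y) =
      ∫⁻ s in Ioi 0, ∫⁻ l in Ioi 0,
        ENNReal.ofReal (s ^ 2)⁻¹ * G (l * s / (l + s), (l + s) / s ^ 2) := by
  let H : ℝ → ℝ → ENNReal := fun w s => ENNReal.ofReal ((s - w) ^ 2)⁻¹ * G (w, (s - w)⁻¹)
  let D : Set (ℝ × ℝ) := {z | 0 < z.1 ∧ z.1 < z.2}
  have hD : MeasurableSet D :=
    (measurableSet_lt measurable_const measurable_fst).inter
      (measurableSet_lt measurable_fst measurable_snd)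
  have hH : Measurable (Function.uncurry H) := by
    have h1 : Measurable fun z : ℝ × ℝ => G (z.1, (z.2 - z.1)⁻¹) := hG.comp (by fun_prop)
    have h2 : Measurable fun z : ℝ × ℝ => ENNReal.ofReal ((z.2 - z.1) ^ 2)⁻¹ := by fun_prop
    exact h2.mul h1
  calc ∫⁻ w in Ioi 0, ∫⁻ y in Ioi 0, G (w, y)
      = ∫⁻ w in Ioi 0, ∫⁻ s in Ioi w, H w s :=
        lintegral_congr fun w => lintegral_Ioi_comp_inv_sub w fun y => G (w, y)
    _ = ∫⁻ w, ∫⁻ s, D.indicator (Function.uncurry H) (w, s) := by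
        rw [← lintegral_indicator measurableSet_Ioi]
        refine lintegral_congr fun w => ?_
        by_cases hw : 0 < w
        · rw [indicator_of_mem (mem_Ioi.2 hw), ← lintegral_indicator measurableSet_Ioi]
          refine lintegral_congr fun s => ?_
          simp [indicator, D, hw]
        · simp [indicator, D, hw]
    _ = ∫⁻ s, ∫⁻ w, D.indicator (Function.uncurry H) (w, s) :=
        lintegral_lintegral_swap (f := fun w s => D.indicator (Function.uncurry H) (w, s))
          (hH.indicator hD).aemeasurable
    _ = ∫⁻ s in Ioi 0, ∫⁻ w in Ioo 0 s, H w s := by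
        rw [← lintegral_indicator measurableSet_Ioi]
        refine lintegral_congr fun s => ?_
        by_cases hs : 0 < s
        · rw [indicator_of_mem (mem_Ioi.2 hs), ← lintegral_indicator measurableSet_Ioo]
          refine lintegral_congr fun w => ?_
          simp [indicator, D]
        · rw [indicator_of_notMem (by simpa using hs), lintegral_eq_zero_of_ae_eq_zero]
          refine Filter.Eventually.of_forall fun w => indicator_of_notMem ?_ _
          rintro ⟨h1, h2⟩
          exact hs (h1.trans h2)
    _ = _ := by
        refine setLIntegral_congr_fun measurableSet_Ioi fun s hs => ?_
        have hs : 0 < s := hs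
        rw [lintegral_Ioo_comp_harmonic hs]
        refine setLIntegral_congr_fun measurableSet_Ioi fun l hl => ?_
        have hl : 0 < l := hl
        have h : s - l * s / (l + s) = s ^ 2 / (l + s) := by
          field_simp
          ring
        simp only [H, h, inv_div, ← mul_assoc]
        rw [← ENNReal.ofReal_mul (by positivity)]
        congr 2
        field_simp

/-- Density of `w + y⁻¹` for independent `w ~ GIG(p; 1, 1)` and `y ~ GIG(p; a⁻¹, 1)`, up to the
mass of the conditional law of `w² y + w`. -/
noncomputable def sumWeight (p a s : ℝ) : ENNReal :=
  ENNReal.ofReal (s⁻¹ ^ (p - 1) * (s ^ 2)⁻¹ * Real.exp (-(s + 1 / s + 1 / (s * a)) / 2))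

lemma measurable_sumWeight (p a : ℝ) : Measurable (sumWeight p a) := by
  unfold sumWeight
  fun_prop

lemma gigDensity_mul_gigDensity (p : ℝ) {a s l : ℝ} (ha : 0 < a) (hs : 0 < s) (hl : 0 < l) :
    ENNReal.ofReal (s ^ 2)⁻¹ *
        (gigDensity p 1 1 (l * s / (l + s)) * gigDensity p a⁻¹ 1 ((l + s) / s ^ 2)) =
      sumWeight p a s * gigDensity p (s ^ 2 * a)⁻¹ 1 l := by
  rw [gigDensity_of_pos _ _ _ hl, gigDensity_of_pos _ _ _ (by positivity),
    gigDensity_of_pos _ _ _ (by positivity), sumWeight, ← ENNReal.ofReal_mul (by positivity),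
    ← ENNReal.ofReal_mul (by positivity), ← ENNReal.ofReal_mul (by positivity)]
  congr 1
  have hpow : (l * s / (l + s)) ^ (p - 1) * ((l + s) / s ^ 2) ^ (p - 1) =
      s⁻¹ ^ (p - 1) * l ^ (p - 1) := by
    rw [← Real.mul_rpow (by positivity) (by positivity),
      ← Real.mul_rpow (by positivity) (by positivity)]
    congr 1
    field_simp
  have hexp : Real.exp (-(1 * (l * s / (l + s)) + 1 / (l * s / (l + s))) / 2) *
      Real.exp (-(a⁻¹ * ((l + s) / s ^ 2) + 1 / ((l + s) / s ^ 2)) / 2) =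
      Real.exp (-(s + 1 / s + 1 / (s * a)) / 2) *
      Real.exp (-((s ^ 2 * a)⁻¹ * l + 1 / l) / 2) := by
    rw [← Real.exp_add, ← Real.exp_add]
    congr 1
    field_simp
    ring
  linear_combination (s ^ 2)⁻¹ * (Real.exp (-(1 * (l * s / (l + s)) + 1 / (l * s / (l + s))) / 2) *
      Real.exp (-(a⁻¹ * ((l + s) / s ^ 2) + 1 / ((l + s) / s ^ 2)) / 2)) * hpow +
    (s ^ 2)⁻¹ * (s⁻¹ ^ (p - 1) * l ^ (p - 1)) * hexp

lemma lintegral_bind_K_P (p : ℝ) {a : ℝ} (ha : 0 < a) {f : ℝ × ℝ → ENNReal}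
    (hf : Measurable f) :
    ∫⁻ r, f r ∂Measure.bind (K p a) (P p) =
      (gigMass p a⁻¹ 1)⁻¹ * (gigMass p 1 1)⁻¹ *
        ∫⁻ s in Ioi 0, sumWeight p a s *
          ∫⁻ l, gigDensity p (s ^ 2 * a)⁻¹ 1 l * f (s ^ 2 * a, l) := by
  let T : ℝ × ℝ → ℝ × ℝ := fun z => ((z.1 + z.2⁻¹) ^ 2 * a, z.1 ^ 2 * z.2 + z.1)
  have hT : Measurable T := by fun_prop
  let G : ℝ × ℝ → ENNReal := fun z => gigDensity p 1 1 z.1 * gigDensity p a⁻¹ 1 z.2 * f (T z)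
  have hG : Measurable G :=
    (((measurable_gigDensity_right p 1 1).comp measurable_fst).mul
      ((measurable_gigDensity_right p a⁻¹ 1).comp measurable_snd)).mul (hf.comp hT)
  have hinner : Measurable fun y => ∫⁻ w, gigDensity p 1 1 w * f (T (w, y)) :=
    Measurable.lintegral_prod_left' (f := fun z : ℝ × ℝ => gigDensity p 1 1 z.1 * f (T z))
      (((measurable_gigDensity_right p 1 1).comp measurable_fst).mul (hf.comp hT))
  have houter : Measurable fun y =>
      gigDensity p a⁻¹ 1 y * ∫⁻ w, gigDensity p 1 1 w * f (T (w, y)) :=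
    (measurable_gigDensity_right p a⁻¹ 1).mul hinner
  have hTs : ∀ y, Measurable fun w => gigDensity p 1 1 w * f (T (w, y)) := fun y =>
    (measurable_gigDensity_right p 1 1).mul (hf.comp (hT.comp measurable_prodMk_right))
  have hPf : Measurable fun q => ∫⁻ r, f r ∂P p q :=
    (Measure.measurable_lintegral hf).comp (measurable_P p)
  rw [Measure.lintegral_bind (measurable_P p).aemeasurable hf.aemeasurable, lintegral_K p a hPf]
  simp only [lintegral_P p _ hf]
  rw [mul_assoc]
  congr 1
  calc ∫⁻ y, gigDensity p a⁻¹ 1 y *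
        ((gigMass p 1 1)⁻¹ * ∫⁻ w, gigDensity p 1 1 w * f (T (w, y)))
      = (gigMass p 1 1)⁻¹ * ∫⁻ y, gigDensity p a⁻¹ 1 y *
          ∫⁻ w, gigDensity p 1 1 w * f (T (w, y)) := by
        rw [← lintegral_const_mul _ houter]
        exact lintegral_congr fun y => mul_left_comm _ _ _
    _ = (gigMass p 1 1)⁻¹ * ∫⁻ y in Ioi 0, ∫⁻ w in Ioi 0, G (w, y) := by
        rw [lintegral_gigDensity_mul]
        congr 1
        refine lintegral_congr fun y => ?_
        rw [lintegral_gigDensity_mul, ← lintegral_const_mul _ (hTs y)]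
        refine lintegral_congr fun w => ?_
        simp only [G]
        ring
    _ = (gigMass p 1 1)⁻¹ * ∫⁻ w in Ioi 0, ∫⁻ y in Ioi 0, G (w, y) := by
        rw [lintegral_lintegral_swap (f := fun w y => G (w, y)) hG.aemeasurable]
    _ = _ := by
        rw [lintegral_quadrant_comp hG]
        congr 1
        refine setLIntegral_congr_fun measurableSet_Ioi fun s hs => ?_
        have hs : 0 < s := hs
        have hm : Measurable fun l => gigDensity p (s ^ 2 * a)⁻¹ 1 l * f (s ^ 2 * a, l) :=
          (measurable_gigDensity_right p _ 1).mul (hf.comp measurable_prodMk_left)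
        rw [lintegral_gigDensity_mul, ← lintegral_const_mul _ hm]
        refine setLIntegral_congr_fun measurableSet_Ioi fun l hl => ?_
        have hl : 0 < l := hl
        have hT' : T (l * s / (l + s), (l + s) / s ^ 2) = (s ^ 2 * a, l) := by
          refine Prod.ext ?_ ?_
          · simp only [T]
            field_simp
          · simp only [T]
            field_simp
        simp only [G, hT']
        rw [← mul_assoc, gigDensity_mul_gigDensity p ha hs hl, mul_assoc]

/-- Intertwining relation `𝒦 ∘ 𝒫 = 𝒬 ∘ 𝒦` for the scalar Matsumoto–Yor chain. -/
theorem stmt_5 (p : ℝ) :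
    ∀ a : ℝ, 0 < a →
      Measure.bind (K p a) (P p) = Measure.bind (Q p a) (K p) := by
  intro a ha
  refine Measure.ext_of_lintegral _ fun f hf => ?_
  have hKf : Measurable fun b => ∫⁻ r, f r ∂K p b :=
    (Measure.measurable_lintegral hf).comp (measurable_K p)
  have hKf' : Measurable fun q : ℝ × ℝ => ∫⁻ r, f r ∂K p q.1 := hKf.comp measurable_fst
  rw [Measure.lintegral_bind (measurable_K p).aemeasurable hf.aemeasurable, Q,
    lintegral_map hKf measurable_fst, lintegral_bind_K_P p ha hKf',
    lintegral_bind_K_P p ha hf]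
  congr 1
  refine setLIntegral_congr_fun measurableSet_Ioi fun s hs => ?_
  have hs : 0 < s := hs
  simp only
  rw [lintegral_mul_const _ (measurable_gigDensity_right p _ 1), lintegral_K p _ hf]
  change _ = _ * (gigMass p (s ^ 2 * a)⁻¹ 1 * _)
  rw [ENNReal.mul_inv_cancel_left (gigMass_ne_zero p _ 1)
    (gigMass_ne_top p (by positivity) one_pos)]
end

section
/- Fix an integer r ≥ 1 and p > (r-1)/2. Let X and w be independent random elements of Sym_r such that X is almost surely positive definite, the law of X⁻¹ is the Wishart distribution W_r(p), and the law of w is the matrix GIG distribution GIG_r(p). Then the random matrix w⁻¹·X·w⁻¹ + w⁻¹ has the same law as X. -/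
open Matrix MeasureTheory ProbabilityTheory

noncomputable instance matrixNormedAddCommGroup (r : ℕ) :
    NormedAddCommGroup (Matrix (Fin r) (Fin r) ℝ) :=
  Matrix.normedAddCommGroup

noncomputable instance matrixNormedSpace (r : ℕ) :
    NormedSpace ℝ (Matrix (Fin r) (Fin r) ℝ) :=
  Matrix.normedSpace

/-- The real vector space `Sym_r` of symmetric `r × r` real matrices. -/
def symSubmodule (r : ℕ) : Submodule ℝ (Matrix (Fin r) (Fin r) ℝ) where
  carrier := {A | A.IsSymm}
  add_mem' hA hB := hA.add hB
  zero_mem' := Matrix.isSymm_zero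
  smul_mem' c _ hA := hA.smul c

instance symMeasurableSpace (r : ℕ) : MeasurableSpace (symSubmodule r) := borel _

instance symBorelSpace (r : ℕ) : BorelSpace (symSubmodule r) := ⟨rfl⟩

open Classical in
/-- Unnormalized density of the matrix GIG distribution `GIG_r(p)` with respect to a Haar
measure on `Sym_r`: `x ↦ det(x)^(p-(r+1)/2) · exp(-(tr(x) + tr(x⁻¹))/2)` on positive
definite matrices, `0` elsewhere. -/
noncomputable def gigMatrixDensity (r : ℕ) (p : ℝ) (x : symSubmodule r) : ENNReal :=
  if (x : Matrix (Fin r) (Fin r) ℝ).PosDef then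
    ENNReal.ofReal ((x : Matrix (Fin r) (Fin r) ℝ).det ^ (p - (r + 1) / 2) *
      Real.exp (-((x : Matrix (Fin r) (Fin r) ℝ).trace +
        ((x : Matrix (Fin r) (Fin r) ℝ)⁻¹).trace) / 2))
  else 0

/-- The matrix GIG distribution `GIG_r(p)` on `Sym_r`, normalized with respect to the Haar
measure `μH`. -/
noncomputable def gigMatrix (r : ℕ) (μH : Measure (symSubmodule r)) (p : ℝ) :
    Measure (symSubmodule r) :=
  ((μH.withDensity (gigMatrixDensity r p)) Set.univ)⁻¹ • μH.withDensity (gigMatrixDensity r p)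

open Classical in
/-- Unnormalized density of the Wishart distribution `W_r(p)` with respect to a Haar
measure on `Sym_r`: `x ↦ det(x)^(p-(r+1)/2) · exp(-tr(x)/2)` on positive definite matrices. -/
noncomputable def wishartDensity (r : ℕ) (p : ℝ) (x : symSubmodule r) : ENNReal :=
  if (x : Matrix (Fin r) (Fin r) ℝ).PosDef then
    ENNReal.ofReal ((x : Matrix (Fin r) (Fin r) ℝ).det ^ (p - (r + 1) / 2) *
      Real.exp (-(x : Matrix (Fin r) (Fin r) ℝ).trace / 2))
  else 0

/-- The Wishart distribution `W_r(p)` on `Sym_r`, normalized with respect to the Haar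
measure `μH`. -/
noncomputable def wishart (r : ℕ) (μH : Measure (symSubmodule r)) (p : ℝ) :
    Measure (symSubmodule r) :=
  ((μH.withDensity (wishartDensity r p)) Set.univ)⁻¹ • μH.withDensity (wishartDensity r p)

theorem symSubmodule_inv_mem (r : ℕ) (x : symSubmodule r) :
    (x : Matrix (Fin r) (Fin r) ℝ)⁻¹ ∈ symSubmodule r := by
  have hx : (x : Matrix (Fin r) (Fin r) ℝ).IsSymm := x.2
  unfold symSubmodule
  show ((x : Matrix (Fin r) (Fin r) ℝ)⁻¹).IsSymm
  unfold Matrix.IsSymm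
  rw [Matrix.transpose_nonsing_inv, hx.eq]

/-- The matrix inverse as a map `Sym_r → Sym_r`. -/
noncomputable def symInv (r : ℕ) (x : symSubmodule r) : symSubmodule r :=
  ⟨(x : Matrix (Fin r) (Fin r) ℝ)⁻¹, symSubmodule_inv_mem r x⟩

theorem symSubmodule_quadInvAdd_mem (r : ℕ) (w x : symSubmodule r) :
    (w : Matrix (Fin r) (Fin r) ℝ)⁻¹ * x * (w : Matrix (Fin r) (Fin r) ℝ)⁻¹ +
      (w : Matrix (Fin r) (Fin r) ℝ)⁻¹ ∈ symSubmodule r := by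
  have hw : ((w : Matrix (Fin r) (Fin r) ℝ)⁻¹).IsSymm := symSubmodule_inv_mem r w
  have hx : (x : Matrix (Fin r) (Fin r) ℝ).IsSymm := x.2
  refine Matrix.IsSymm.add ?_ hw
  simp only [Matrix.IsSymm, Matrix.transpose_mul, hw.eq, hx.eq, Matrix.mul_assoc]

/-- The map `(w, x) ↦ w⁻¹ · x · w⁻¹ + w⁻¹` on `Sym_r`. -/
noncomputable def quadInvAdd (r : ℕ) (w x : symSubmodule r) : symSubmodule r :=
  ⟨(w : Matrix (Fin r) (Fin r) ℝ)⁻¹ * x * (w : Matrix (Fin r) (Fin r) ℝ)⁻¹ +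
      (w : Matrix (Fin r) (Fin r) ℝ)⁻¹, symSubmodule_quadInvAdd_mem r w x⟩

instance symSecondCountableTopology (r : ℕ) : SecondCountableTopology (symSubmodule r) :=
  have := FiniteDimensional.proper_real (symSubmodule r)
  secondCountable_of_proper (α := symSubmodule r)

instance symSigmaCompactSpace (r : ℕ) : SigmaCompactSpace (symSubmodule r) :=
  have : SigmaCompactSpace (Matrix (Fin r) (Fin r) ℝ) :=
    inferInstanceAs (SigmaCompactSpace (Fin r → Fin r → ℝ))
  (symSubmodule r).closed_of_finiteDimensional.isClosedEmbedding_subtypeVal.sigmaCompactSpace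

/-- The congruence action `h ↦ M · h · Mᵀ` of a matrix on `Sym_r`. -/
def symCongr (r : ℕ) (M : Matrix (Fin r) (Fin r) ℝ) : symSubmodule r →ₗ[ℝ] symSubmodule r where
  toFun h := ⟨M * h * Mᵀ, by
    have hh : (h : Matrix (Fin r) (Fin r) ℝ).IsSymm := h.2
    change (M * h * Mᵀ).IsSymm
    simp only [Matrix.IsSymm, Matrix.transpose_mul, Matrix.transpose_transpose, hh.eq,
      Matrix.mul_assoc]⟩
  map_add' a b := by ext1; simp [Matrix.mul_add, Matrix.add_mul]
  map_smul' c a := by ext1; simp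

theorem symCongr_mul (r : ℕ) (M N : Matrix (Fin r) (Fin r) ℝ) :
    symCongr r (M * N) = symCongr r M ∘ₗ symCongr r N := by
  ext1 h
  ext1
  simp [symCongr, Matrix.mul_assoc]

theorem symCongr_one (r : ℕ) : symCongr r 1 = LinearMap.id := by
  ext1 h
  ext1
  simp [symCongr]

/-- A symmetric matrix is determined by its entries on and above the diagonal. -/
def symUpperEquiv (r : ℕ) :
    symSubmodule r ≃ₗ[ℝ] ({q : Fin r × Fin r // q.1 ≤ q.2} → ℝ) where
  toFun h q := (h : Matrix (Fin r) (Fin r) ℝ) q.1.1 q.1.2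
  map_add' a b := rfl
  map_smul' c a := rfl
  invFun f := ⟨Matrix.of fun i j => f ⟨(min i j, max i j), min_le_max⟩, by
    change Matrix.IsSymm _
    ext i j
    simp only [Matrix.transpose_apply, Matrix.of_apply, min_comm, max_comm]⟩
  left_inv h := by
    have hh : (h : Matrix (Fin r) (Fin r) ℝ).IsSymm := h.2
    ext i j
    rcases le_total i j with hij | hij
    · simp [hij]
    · simpa [hij] using hh.apply i j
  right_inv f := by
    ext ⟨⟨i, j⟩, hij⟩
    have hij' : i ≤ j := hij
    simp [hij']

theorem prod_upper_mul (r : ℕ) (d : Fin r → ℝ) :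
    ∏ q : {q : Fin r × Fin r // q.1 ≤ q.2}, d q.1.1 * d q.1.2 = (∏ i, d i) ^ (r + 1) := by
  rw [← Finset.prod_subtype (Finset.univ.filter fun q : Fin r × Fin r => q.1 ≤ q.2) (by simp)
    (fun q : Fin r × Fin r => d q.1 * d q.2), Finset.prod_mul_distrib, Finset.prod_filter,
    Finset.prod_filter, Fintype.prod_prod_type, Fintype.prod_prod_type_right,
    ← Finset.prod_mul_distrib, ← Finset.prod_pow]
  refine Finset.prod_congr rfl fun i _ => ?_
  have h : ∀ j, (if i ≤ j then d i else 1) * (if j ≤ i then d i else 1)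
      = d i * (if j = i then d i else 1) := by
    intro j
    rcases lt_trichotomy i j with h | h | h
    · simp [h.le, h.not_ge, h.ne']
    · simp [h]
    · simp [h.le, h.not_ge, h.ne]
  rw [← Finset.prod_mul_distrib, Finset.prod_congr rfl fun j _ => h j, Finset.prod_mul_distrib]
  simp [pow_succ]

theorem det_symCongr_diagonal (r : ℕ) (d : Fin r → ℝ) :
    LinearMap.det (symCongr r (Matrix.diagonal d)) = (∏ i, d i) ^ (r + 1) := by
  have h : ((symUpperEquiv r : symSubmodule r →ₗ[ℝ] _) ∘ₗ symCongr r (Matrix.diagonal d) ∘ₗ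
      ((symUpperEquiv r).symm : _ →ₗ[ℝ] symSubmodule r)) =
      Matrix.toLin' (Matrix.diagonal fun q : {q : Fin r × Fin r // q.1 ≤ q.2} =>
        d q.1.1 * d q.1.2) := by
    refine LinearMap.ext fun f => funext fun ⟨⟨i, j⟩, hij⟩ => ?_
    have hij' : i ≤ j := hij
    change (Matrix.diagonal d * (Matrix.of fun i j => f ⟨(min i j, max i j), min_le_max⟩) *
      (Matrix.diagonal d)ᵀ) i j = _
    simp [Matrix.mulVec_diagonal, hij']
    ring
  rw [← LinearMap.det_conj _ (symUpperEquiv r), h, LinearMap.det_toLin', Matrix.det_diagonal,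
    prod_upper_mul]

theorem det_symCongr_of_isSymm (r : ℕ) {A : Matrix (Fin r) (Fin r) ℝ} (hA : A.IsSymm) :
    LinearMap.det (symCongr r A) = A.det ^ (r + 1) := by
  have hA' : A.IsHermitian := by
    rw [Matrix.IsHermitian, Matrix.conjTranspose_eq_transpose_of_trivial, hA.eq]
  set U : Matrix (Fin r) (Fin r) ℝ := (hA'.eigenvectorUnitary : Matrix (Fin r) (Fin r) ℝ)
  have hspec : A = U * Matrix.diagonal hA'.eigenvalues * star U := by
    simpa [Unitary.conjStarAlgAut_apply, Function.comp_def] using hA'.spectral_theorem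
  have hU : U * star U = 1 := Unitary.coe_mul_star_self hA'.eigenvectorUnitary
  have hdet : LinearMap.det (symCongr r U) * LinearMap.det (symCongr r (star U)) = 1 := by
    rw [← LinearMap.det_comp, ← symCongr_mul, hU, symCongr_one, LinearMap.det_id]
  rw [hA'.det_eq_prod_eigenvalues]
  nth_rewrite 1 [hspec]
  rw [symCongr_mul, symCongr_mul, LinearMap.det_comp, LinearMap.det_comp, det_symCongr_diagonal,
    mul_right_comm, hdet, one_mul]
  rfl

section

attribute [local instance] Matrix.linftyOpNormedRing Matrix.linftyOpNormedAlgebra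

theorem hasFDerivAt_matrixInv_linfty (r : ℕ) {A : Matrix (Fin r) (Fin r) ℝ} (hA : IsUnit A) :
    HasFDerivAt (fun B : Matrix (Fin r) (Fin r) ℝ => B⁻¹)
      (-(ContinuousLinearMap.mulLeftRight ℝ (Matrix (Fin r) (Fin r) ℝ) A⁻¹) A⁻¹) A := by
  have hc : @CompleteSpace (Matrix (Fin r) (Fin r) ℝ)
      (Matrix.linftyOpNormedRing (α := ℝ) (n := Fin r)).toPseudoMetricSpace.toUniformSpace :=
    inferInstanceAs (CompleteSpace (Fin r → Fin r → ℝ))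
  obtain ⟨u, rfl⟩ := hA
  have h := hasFDerivAt_ringInverse (𝕜 := ℝ) u
  rw [Matrix.coe_units_inv] at h
  rwa [show (fun B : Matrix (Fin r) (Fin r) ℝ => B⁻¹) = Ring.inverse from
    funext Matrix.nonsing_inv_eq_ringInverse]

end

theorem hasFDerivAt_matrixInv (r : ℕ) {A : Matrix (Fin r) (Fin r) ℝ} (hA : IsUnit A) :
    ∃ L : Matrix (Fin r) (Fin r) ℝ →L[ℝ] Matrix (Fin r) (Fin r) ℝ,
      (∀ H, L H = -(A⁻¹ * H * A⁻¹)) ∧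
      HasFDerivAt (fun B : Matrix (Fin r) (Fin r) ℝ => B⁻¹) L A :=
  ⟨_, fun _ => rfl, hasFDerivAt_matrixInv_linfty r hA⟩

/-- The symmetrization `A ↦ (A + Aᵀ) / 2`. -/
noncomputable def symPart (r : ℕ) : Matrix (Fin r) (Fin r) ℝ →ₗ[ℝ] symSubmodule r where
  toFun A := ⟨(2⁻¹ : ℝ) • (A + Aᵀ), (Matrix.isSymm_add_transpose_self A).smul _⟩
  map_add' A B := by ext1; simp; abel_nf
  map_smul' c A := by ext1; simp [smul_comm c]

theorem symPart_coe (r : ℕ) (x : symSubmodule r) : symPart r x = x := by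
  have hx : (x : Matrix (Fin r) (Fin r) ℝ).IsSymm := x.2
  ext1
  simp [symPart, hx.eq, ← two_smul ℝ]

theorem hasFDerivAt_symInv (r : ℕ) {x : symSubmodule r}
    (hx : IsUnit (x : Matrix (Fin r) (Fin r) ℝ)) :
    HasFDerivAt (symInv r) (LinearMap.toContinuousLinearMap
      (-symCongr r (x : Matrix (Fin r) (Fin r) ℝ)⁻¹)) x := by
  obtain ⟨L, hL, hd⟩ := hasFDerivAt_matrixInv r hx
  have h : HasFDerivAt (fun y : symSubmodule r => symPart r (y : Matrix (Fin r) (Fin r) ℝ)⁻¹)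
      (LinearMap.toContinuousLinearMap (symPart r) ∘L L ∘L (symSubmodule r).subtypeL) x :=
    (LinearMap.toContinuousLinearMap (symPart r)).hasFDerivAt.comp x
      (hd.comp x (symSubmodule r).subtypeL.hasFDerivAt)
  rw [show symInv r = fun y : symSubmodule r => symPart r (y : Matrix (Fin r) (Fin r) ℝ)⁻¹ from
    funext fun y => (symPart_coe r (symInv r y)).symm]
  refine h.congr_fderiv (ContinuousLinearMap.ext fun y => ?_)
  have hs : ((x : Matrix (Fin r) (Fin r) ℝ)⁻¹).IsSymm := symSubmodule_inv_mem r x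
  have hLy : L y = ((-symCongr r (x : Matrix (Fin r) (Fin r) ℝ)⁻¹ y : symSubmodule r) :
      Matrix (Fin r) (Fin r) ℝ) := by
    simp [hL, symCongr, hs.eq]
  change symPart r (L y) = -symCongr r (x : Matrix (Fin r) (Fin r) ℝ)⁻¹ y
  rw [hLy, symPart_coe]

theorem measurable_symInv (r : ℕ) : Measurable (symInv r) := by
  have hcont : Continuous fun x : symSubmodule r =>
      symPart r (x : Matrix (Fin r) (Fin r) ℝ).adjugate :=
    (symPart r).continuous_of_finiteDimensional.comp (by fun_prop)
  have hdet : Continuous fun x : symSubmodule r => (x : Matrix (Fin r) (Fin r) ℝ).det := by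
    fun_prop
  have h : symInv r = fun x : symSubmodule r => (x : Matrix (Fin r) (Fin r) ℝ).det⁻¹ •
      symPart r (x : Matrix (Fin r) (Fin r) ℝ).adjugate := by
    funext x
    rw [← map_smul, ← symPart_coe r (symInv r x)]
    simp [symInv, Matrix.inv_def]
  rw [h]
  exact hdet.measurable.inv.smul hcont.measurable

theorem measurableSet_posDef (r : ℕ) :
    MeasurableSet {x : symSubmodule r | (x : Matrix (Fin r) (Fin r) ℝ).PosDef} := by
  have h : {x : symSubmodule r | (x : Matrix (Fin r) (Fin r) ℝ).PosDef} =
      (⋂ v : Fin r → ℝ, {x : symSubmodule r | 0 ≤ v ⬝ᵥ ((x : Matrix (Fin r) (Fin r) ℝ) *ᵥ v)}) ∩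
        {x : symSubmodule r | (x : Matrix (Fin r) (Fin r) ℝ).det ≠ 0} := by
    ext x
    have hx : (x : Matrix (Fin r) (Fin r) ℝ).IsHermitian := by
      rw [Matrix.IsHermitian, Matrix.conjTranspose_eq_transpose_of_trivial]
      exact x.2
    simp only [Set.mem_ofPred_eq, Set.mem_inter_iff, Set.mem_iInter]
    constructor
    · intro h
      exact ⟨fun v => by simpa using (posSemidef_iff_dotProduct_mulVec.1 h.posSemidef).2 v,
        h.det_pos.ne'⟩
    · rintro ⟨h, hd⟩
      exact (PosSemidef.posDef_iff_det_ne_zero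
        (posSemidef_iff_dotProduct_mulVec.2 ⟨hx, by simpa using h⟩)).2 hd
  rw [h]
  refine MeasurableSet.inter (IsClosed.measurableSet (isClosed_iInter fun v => ?_))
    (IsOpen.measurableSet ?_)
  · exact isClosed_le continuous_const (by fun_prop)
  · exact isOpen_ne_fun (by fun_prop) continuous_const

theorem measurable_wishartDensity (r : ℕ) (p : ℝ) : Measurable (wishartDensity r p) := by
  classical
  have hdet : Continuous fun x : symSubmodule r => (x : Matrix (Fin r) (Fin r) ℝ).det := by
    fun_prop
  have htr : Continuous fun x : symSubmodule r => (x : Matrix (Fin r) (Fin r) ℝ).trace := by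
    fun_prop
  have h1 := hdet.measurable
  have h2 := htr.measurable
  unfold wishartDensity
  exact Measurable.ite (measurableSet_posDef r) (by fun_prop) measurable_const

theorem measurable_gigMatrixDensity (r : ℕ) (p : ℝ) : Measurable (gigMatrixDensity r p) := by
  classical
  have hdet : Continuous fun x : symSubmodule r => (x : Matrix (Fin r) (Fin r) ℝ).det := by
    fun_prop
  have htr : Continuous fun x : symSubmodule r => (x : Matrix (Fin r) (Fin r) ℝ).trace := by
    fun_prop
  have h1 := hdet.measurable
  have h2 := htr.measurable
  have h3 : Measurable fun x : symSubmodule r => ((x : Matrix (Fin r) (Fin r) ℝ)⁻¹).trace :=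
    htr.measurable.comp (measurable_symInv r)
  unfold gigMatrixDensity
  exact Measurable.ite (measurableSet_posDef r) (by fun_prop) measurable_const

theorem symInv_posDef (r : ℕ) {x : symSubmodule r}
    (hx : (x : Matrix (Fin r) (Fin r) ℝ).PosDef) :
    (symInv r x : Matrix (Fin r) (Fin r) ℝ).PosDef := hx.inv

theorem symInv_symInv (r : ℕ) {x : symSubmodule r}
    (hx : (x : Matrix (Fin r) (Fin r) ℝ).PosDef) : symInv r (symInv r x) = x := by
  ext1
  exact Matrix.nonsing_inv_nonsing_inv _ hx.det_pos.ne'.isUnit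

theorem lintegral_posDef_eq_lintegral_symInv (r : ℕ) (μ : Measure (symSubmodule r))
    [μ.IsAddHaarMeasure] (f : symSubmodule r → ENNReal) :
    ∫⁻ x in {x : symSubmodule r | (x : Matrix (Fin r) (Fin r) ℝ).PosDef}, f x ∂μ =
    ∫⁻ x in {x : symSubmodule r | (x : Matrix (Fin r) (Fin r) ℝ).PosDef},
      ENNReal.ofReal ((x : Matrix (Fin r) (Fin r) ℝ).det ^ (-(r + 1 : ℝ))) *
        f (symInv r x) ∂μ := by
  set C : Set (symSubmodule r) := {x | (x : Matrix (Fin r) (Fin r) ℝ).PosDef}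
  have himage : symInv r '' C = C := by
    ext x
    constructor
    · rintro ⟨y, hy, rfl⟩
      exact symInv_posDef r hy
    · intro hx
      exact ⟨symInv r x, symInv_posDef r hx, symInv_symInv r hx⟩
  have hinj : Set.InjOn (symInv r) C := by
    intro x hx y hy hxy
    rw [← symInv_symInv r hx, hxy, symInv_symInv r hy]
  have hborel : @BorelSpace (symSubmodule r)
      (symSubmodule r).normedAddCommGroup.toPseudoMetricSpace.toUniformSpace.toTopologicalSpace _ :=
    ⟨rfl⟩
  have hhaar : @Measure.IsAddHaarMeasure (symSubmodule r)
      (symSubmodule r).normedAddCommGroup.toAddCommGroup.toAddGroup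
      (symSubmodule r).normedAddCommGroup.toPseudoMetricSpace.toUniformSpace.toTopologicalSpace
      _ μ := ‹μ.IsAddHaarMeasure›
  have h := lintegral_image_eq_lintegral_abs_det_fderiv_mul μ (measurableSet_posDef r)
    (fun x hx => (hasFDerivAt_symInv r hx.isUnit).hasFDerivWithinAt) hinj f
  rw [himage] at h
  rw [h]
  refine setLIntegral_congr_fun (measurableSet_posDef r) fun x hx => ?_
  have hpos : 0 < (x : Matrix (Fin r) (Fin r) ℝ).det := PosDef.det_pos hx
  have hdet : |LinearMap.det (-symCongr r (x : Matrix (Fin r) (Fin r) ℝ)⁻¹)| =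
      (x : Matrix (Fin r) (Fin r) ℝ).det ^ (-(r + 1 : ℝ)) := by
    rw [← neg_one_smul ℝ (symCongr r (x : Matrix (Fin r) (Fin r) ℝ)⁻¹), LinearMap.det_smul,
      abs_mul, abs_pow, abs_neg, abs_one, one_pow,
      one_mul, det_symCongr_of_isSymm r (symSubmodule_inv_mem r x), Matrix.det_nonsing_inv,
      Ring.inverse_eq_inv', inv_pow, abs_of_pos (by positivity), Real.rpow_neg hpos.le]
    norm_cast
  change ENNReal.ofReal |LinearMap.det (-symCongr r (x : Matrix (Fin r) (Fin r) ℝ)⁻¹)| * _ = _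
  rw [hdet]

theorem inv_sub_inv_add {r : ℕ} {s t : Matrix (Fin r) (Fin r) ℝ} (hs : s.PosDef)
    (ht : t.PosDef) : s⁻¹ - (s + t)⁻¹ = (s * t⁻¹ * s + s)⁻¹ := by
  have hs' := hs.det_pos.ne'.isUnit
  have ht' := ht.det_pos.ne'.isUnit
  have hst' := (hs.add ht).det_pos.ne'.isUnit
  symm
  apply Matrix.inv_eq_right_inv
  have h : s * t⁻¹ * s + s = s * t⁻¹ * (s + t) := by
    rw [Matrix.mul_add, Matrix.nonsing_inv_mul_cancel_right _ _ ht']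
  rw [h, Matrix.mul_sub, Matrix.mul_nonsing_inv_cancel_right _ _ hst', Matrix.mul_add,
    Matrix.nonsing_inv_mul_cancel_right _ _ ht', Matrix.add_mul, Matrix.mul_nonsing_inv _ hs',
    Matrix.mul_nonsing_inv_cancel_right _ _ hs', add_sub_cancel_left]

theorem posDef_mul_inv_mul_add {r : ℕ} {s t : Matrix (Fin r) (Fin r) ℝ} (hs : s.PosDef)
    (ht : t.PosDef) : (s * t⁻¹ * s + s).PosDef := by
  have h := ht.inv.conjTranspose_mul_mul_same
    (Matrix.mulVec_injective_iff_isUnit.2 hs.isUnit)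
  rw [hs.isHermitian.eq] at h
  exact h.add hs

theorem posDef_inv_sub_inv {r : ℕ} {s w : Matrix (Fin r) (Fin r) ℝ} (hs : s.PosDef)
    (h : (w - s).PosDef) : (s⁻¹ - w⁻¹).PosDef := by
  have h1 := inv_sub_inv_add hs h
  rw [add_sub_cancel] at h1
  rw [h1]
  exact (posDef_mul_inv_mul_add hs h).inv

theorem posDef_inv_sub_inv_iff {r : ℕ} {s w : Matrix (Fin r) (Fin r) ℝ} (hs : s.PosDef)
    (hw : w.PosDef) : (s⁻¹ - w⁻¹).PosDef ↔ (w - s).PosDef := by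
  refine ⟨fun h => ?_, posDef_inv_sub_inv hs⟩
  have h1 := posDef_inv_sub_inv hw.inv h
  rwa [Matrix.nonsing_inv_nonsing_inv _ hw.det_pos.ne'.isUnit,
    Matrix.nonsing_inv_nonsing_inv _ hs.det_pos.ne'.isUnit] at h1

theorem det_inv_sub_inv {r : ℕ} {s w : Matrix (Fin r) (Fin r) ℝ} (hs : s.PosDef)
    (hw : w.PosDef) : (s⁻¹ - w⁻¹).det = s.det⁻¹ * (w - s).det * w.det⁻¹ := by
  have h : s⁻¹ - w⁻¹ = s⁻¹ * (w - s) * w⁻¹ := by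
    rw [Matrix.mul_sub, Matrix.sub_mul,
      Matrix.mul_nonsing_inv_cancel_right _ _ hw.det_pos.ne'.isUnit,
      Matrix.nonsing_inv_mul _ hs.det_pos.ne'.isUnit, Matrix.one_mul]
  rw [h, Matrix.det_mul, Matrix.det_mul, Matrix.det_nonsing_inv, Matrix.det_nonsing_inv,
    Ring.inverse_eq_inv']

/-- The density identity behind the matrix Matsumoto–Yor property. -/
theorem gigMatrixDensity_mul_wishartDensity (r : ℕ) (p : ℝ) {w s : symSubmodule r}
    (hw : (w : Matrix (Fin r) (Fin r) ℝ).PosDef) (hs : (s : Matrix (Fin r) (Fin r) ℝ).PosDef) :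
    gigMatrixDensity r p w *
      (ENNReal.ofReal ((s : Matrix (Fin r) (Fin r) ℝ).det ^ (-(r + 1 : ℝ))) *
        wishartDensity r p (symInv r s - symInv r w)) =
    gigMatrixDensity r (-p) s * wishartDensity r p (w - s) := by
  have hiff : ((symInv r s - symInv r w : symSubmodule r) : Matrix (Fin r) (Fin r) ℝ).PosDef ↔
      ((w - s : symSubmodule r) : Matrix (Fin r) (Fin r) ℝ).PosDef :=
    posDef_inv_sub_inv_iff hs hw
  unfold gigMatrixDensity wishartDensity
  rw [if_pos hw, if_pos hs]
  by_cases hd : ((w - s : symSubmodule r) : Matrix (Fin r) (Fin r) ℝ).PosDef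
  · rw [if_pos hd, if_pos (hiff.2 hd)]
    have hdet := det_inv_sub_inv hs hw
    have hspos := hs.det_pos
    have hwpos := hw.det_pos
    have hdpos := hd.det_pos
    have hcoe : ((symInv r s - symInv r w : symSubmodule r) : Matrix (Fin r) (Fin r) ℝ) =
        (s : Matrix (Fin r) (Fin r) ℝ)⁻¹ - (w : Matrix (Fin r) (Fin r) ℝ)⁻¹ := rfl
    rw [hcoe, hdet, Matrix.trace_sub, Submodule.coe_sub, Matrix.trace_sub]
    rw [Submodule.coe_sub] at hdpos
    rw [← ENNReal.ofReal_mul (by positivity), ← ENNReal.ofReal_mul (by positivity),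
      ← ENNReal.ofReal_mul (by positivity)]
    congr 1
    rw [Real.mul_rpow (by positivity) (by positivity),
      Real.mul_rpow (by positivity) (by positivity), Real.inv_rpow hspos.le,
      Real.inv_rpow hwpos.le]
    have hsexp : (s : Matrix (Fin r) (Fin r) ℝ).det ^ (-p - (r + 1) / 2) =
        (s : Matrix (Fin r) (Fin r) ℝ).det ^ (-(r + 1 : ℝ)) *
          ((s : Matrix (Fin r) (Fin r) ℝ).det ^ (p - (r + 1) / 2))⁻¹ := by
      rw [← Real.rpow_neg hspos.le, ← Real.rpow_add hspos]
      congr 1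
      ring
    rw [hsexp]
    have hwne : (w : Matrix (Fin r) (Fin r) ℝ).det ^ (p - (r + 1) / 2) ≠ 0 := by positivity
    have hexp : ∀ a b c d : ℝ, Real.exp (-(a + b) / 2) * Real.exp (-(c - b) / 2) =
        Real.exp (-(d + c) / 2) * Real.exp (-(a - d) / 2) := by
      intro a b c d
      rw [← Real.exp_add, ← Real.exp_add]
      congr 1
      ring
    have h := hexp (w : Matrix (Fin r) (Fin r) ℝ).trace
      ((w : Matrix (Fin r) (Fin r) ℝ)⁻¹).trace ((s : Matrix (Fin r) (Fin r) ℝ)⁻¹).trace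
      (s : Matrix (Fin r) (Fin r) ℝ).trace
    generalize (w : Matrix (Fin r) (Fin r) ℝ).det ^ (p - (r + 1) / 2) = a at *
    generalize ((w : Matrix (Fin r) (Fin r) ℝ) - s).det ^ (p - (r + 1) / 2) = b at *
    generalize (s : Matrix (Fin r) (Fin r) ℝ).det ^ (-(r + 1 : ℝ)) = c at *
    generalize ((s : Matrix (Fin r) (Fin r) ℝ).det ^ (p - (r + 1) / 2))⁻¹ = d at *
    linear_combination (c * d * b * a * a⁻¹) * h + (c * d * b) *
      (Real.exp (-((s : Matrix (Fin r) (Fin r) ℝ).trace +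
        ((s : Matrix (Fin r) (Fin r) ℝ)⁻¹).trace) / 2) *
      Real.exp (-((w : Matrix (Fin r) (Fin r) ℝ).trace -
        (s : Matrix (Fin r) (Fin r) ℝ).trace) / 2)) * (mul_inv_cancel₀ hwne)
  · rw [if_neg hd, if_neg (fun h => hd (hiff.1 h))]
    simp

theorem lintegral_gig_wishart_transport (r : ℕ) (p : ℝ) (μ : Measure (symSubmodule r))
    [μ.IsAddHaarMeasure] {g : symSubmodule r → ENNReal} (hg : Measurable g) :
    ∫⁻ w, gigMatrixDensity r p w *
        ∫⁻ y, wishartDensity r p y * g (w - symInv r (symInv r w + y)) ∂μ ∂μ =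
      (∫⁻ s, gigMatrixDensity r (-p) s ∂μ) * ∫⁻ t, wishartDensity r p t * g t ∂μ := by
  classical
  have hwis := measurable_wishartDensity r p
  have hgig := measurable_gigMatrixDensity r (-p)
  have hinner : ∀ w, gigMatrixDensity r p w *
      ∫⁻ y, wishartDensity r p y * g (w - symInv r (symInv r w + y)) ∂μ =
      ∫⁻ s, gigMatrixDensity r (-p) s * (wishartDensity r p (w - s) * g (w - s)) ∂μ := by
    intro w
    by_cases hw : (w : Matrix (Fin r) (Fin r) ℝ).PosDef
    · set C : Set (symSubmodule r) := {x | (x : Matrix (Fin r) (Fin r) ℝ).PosDef}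
      have hC : MeasurableSet C := measurableSet_posDef r
      have hshift : ∫⁻ y, wishartDensity r p y * g (w - symInv r (symInv r w + y)) ∂μ =
          ∫⁻ b in C, wishartDensity r p (b - symInv r w) * g (w - symInv r b) ∂μ := by
        rw [← lintegral_sub_right_eq_self _ (symInv r w), ← lintegral_indicator hC]
        refine lintegral_congr fun b => ?_
        rw [add_sub_cancel, Set.indicator_apply]
        split_ifs with hb
        · rfl
        · rw [wishartDensity, if_neg, zero_mul]
          intro h
          have := h.add (symInv_posDef r hw)
          rw [← Submodule.coe_add, sub_add_cancel] at this
          exact hb this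
      have hsupp : ∫⁻ s, gigMatrixDensity r (-p) s *
          (wishartDensity r p (w - s) * g (w - s)) ∂μ =
          ∫⁻ s in C, gigMatrixDensity r (-p) s *
          (wishartDensity r p (w - s) * g (w - s)) ∂μ := by
        rw [← lintegral_indicator hC]
        refine lintegral_congr fun s => ?_
        rw [Set.indicator_apply]
        split_ifs with hs
        · rfl
        · rw [gigMatrixDensity, if_neg (show ¬ (s : Matrix (Fin r) (Fin r) ℝ).PosDef from hs),
            zero_mul]
      rw [hshift, lintegral_posDef_eq_lintegral_symInv r μ, hsupp,
        ← lintegral_const_mul' _ _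
          (by rw [gigMatrixDensity, if_pos hw]; exact ENNReal.ofReal_ne_top)]
      refine setLIntegral_congr_fun hC fun s hs => ?_
      rw [symInv_symInv r hs, ← mul_assoc _ (wishartDensity r p (w - s)),
        ← gigMatrixDensity_mul_wishartDensity r p hw hs]
      ring
    · rw [gigMatrixDensity, if_neg hw, zero_mul]
      refine (lintegral_eq_zero_of_ae_eq_zero (ae_of_all _ fun s => ?_)).symm
      by_cases hs : (s : Matrix (Fin r) (Fin r) ℝ).PosDef
      · have hws : ¬ ((w - s : symSubmodule r) : Matrix (Fin r) (Fin r) ℝ).PosDef := by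
          intro h
          have := h.add hs
          rw [← Submodule.coe_add, sub_add_cancel] at this
          exact hw this
        rw [wishartDensity, if_neg hws, zero_mul, mul_zero, Pi.zero_apply]
      · simp [gigMatrixDensity, if_neg hs]
  simp_rw [hinner]
  rw [lintegral_lintegral_swap (by fun_prop), ← lintegral_mul_const _ hgig]
  refine lintegral_congr fun s => ?_
  rw [lintegral_const_mul _ (by fun_prop),
    lintegral_sub_right_eq_self (fun t : symSubmodule r => wishartDensity r p t * g t) s]

theorem posDef_ae_gigMatrix (r : ℕ) (p : ℝ) (μH : Measure (symSubmodule r)) :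
    ∀ᵐ w : symSubmodule r ∂gigMatrix r μH p, (w : Matrix (Fin r) (Fin r) ℝ).PosDef := by
  classical
  refine Measure.ae_smul_measure ?_ _
  rw [ae_withDensity_iff (measurable_gigMatrixDensity r p)]
  refine ae_of_all _ fun w hw => ?_
  by_contra h
  exact hw (if_neg h)

theorem map_gigMatrix_prod_wishart (r : ℕ) (p : ℝ) (μH : Measure (symSubmodule r))
    [μH.IsAddHaarMeasure] [IsProbabilityMeasure (wishart r μH p)]
    [IsProbabilityMeasure (gigMatrix r μH p)] :
    ((gigMatrix r μH p).prod (wishart r μH p)).map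
      (fun z => z.1 - symInv r (symInv r z.1 + z.2)) = wishart r μH p := by
  have hwis := measurable_wishartDensity r p
  have hgig := measurable_gigMatrixDensity r p
  have hinv := measurable_symInv r
  have hT : Measurable fun z : symSubmodule r × symSubmodule r =>
      z.1 - symInv r (symInv r z.1 + z.2) := by fun_prop
  set cG := (μH.withDensity (gigMatrixDensity r p)) Set.univ
  set cW := (μH.withDensity (wishartDensity r p)) Set.univ
  have hlaw : ∀ g : symSubmodule r → ENNReal, Measurable g →
      ∫⁻ z, g z ∂((gigMatrix r μH p).prod (wishart r μH p)).map
        (fun z => z.1 - symInv r (symInv r z.1 + z.2)) =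
      (cG⁻¹ * ∫⁻ s, gigMatrixDensity r (-p) s ∂μH) * ∫⁻ z, g z ∂wishart r μH p := by
    intro g hg
    rw [lintegral_map hg hT, lintegral_prod _ (by fun_prop)]
    simp_rw [gigMatrix, wishart, lintegral_smul_measure, smul_eq_mul]
    have hK : Measurable fun z : symSubmodule r × symSubmodule r =>
        g (z.1 - symInv r (symInv r z.1 + z.2)) := hg.comp hT
    have hK' : Measurable fun z : symSubmodule r × symSubmodule r =>
        wishartDensity r p z.2 * g (z.1 - symInv r (symInv r z.1 + z.2)) :=
      (hwis.comp measurable_snd).mul hK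
    have hL : Measurable fun w => gigMatrixDensity r p w * ∫⁻ y, wishartDensity r p y *
        g (w - symInv r (symInv r w + y)) ∂μH := hgig.mul hK'.lintegral_prod_right'
    rw [lintegral_withDensity_eq_lintegral_mul _ hgig (hK.lintegral_prod_right'.const_mul _),
      lintegral_withDensity_eq_lintegral_mul _ hwis hg]
    have h : ∀ w, (gigMatrixDensity r p * fun w => cW⁻¹ *
        ∫⁻ y, g (w - symInv r (symInv r w + y)) ∂μH.withDensity (wishartDensity r p)) w =
        cW⁻¹ * (gigMatrixDensity r p w *
        ∫⁻ y, wishartDensity r p y * g (w - symInv r (symInv r w + y)) ∂μH) := by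
      intro w
      rw [Pi.mul_apply, lintegral_withDensity_eq_lintegral_mul _ hwis (by fun_prop)]
      simp only [Pi.mul_apply]
      ring
    rw [lintegral_congr h, lintegral_const_mul _ hL,
      lintegral_gig_wishart_transport r p μH hg]
    simp only [Pi.mul_apply]
    ring
  have : IsProbabilityMeasure (((gigMatrix r μH p).prod (wishart r μH p)).map
      (fun z => z.1 - symInv r (symInv r z.1 + z.2))) :=
    Measure.isProbabilityMeasure_map hT.aemeasurable
  have h1 := hlaw (fun _ => 1) measurable_const
  simp only [lintegral_const, measure_univ, mul_one] at h1
  refine Measure.ext_of_lintegral _ fun g hg => ?_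
  rw [hlaw g hg, ← h1, one_mul]

theorem symInv_quadInvAdd (r : ℕ) {w x : symSubmodule r}
    (hw : (w : Matrix (Fin r) (Fin r) ℝ).PosDef) (hx : (x : Matrix (Fin r) (Fin r) ℝ).PosDef) :
    symInv r (quadInvAdd r w x) = w - symInv r (symInv r w + symInv r x) := by
  ext1
  have h := inv_sub_inv_add hw.inv hx.inv
  rw [Matrix.nonsing_inv_nonsing_inv _ hw.det_pos.ne'.isUnit,
    Matrix.nonsing_inv_nonsing_inv _ hx.det_pos.ne'.isUnit] at h
  exact h.symm

theorem quadInvAdd_posDef (r : ℕ) {w x : symSubmodule r}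
    (hw : (w : Matrix (Fin r) (Fin r) ℝ).PosDef) (hx : (x : Matrix (Fin r) (Fin r) ℝ).PosDef) :
    (quadInvAdd r w x : Matrix (Fin r) (Fin r) ℝ).PosDef := by
  have h := posDef_mul_inv_mul_add hw.inv hx.inv
  rwa [Matrix.nonsing_inv_nonsing_inv _ hx.det_pos.ne'.isUnit] at h

/-- Invariance of the inverse Wishart distribution: if `X` and `w` are independent,
`X⁻¹ ~ W_r(p)` and `w ~ GIG_r(p)` with `p > (r-1)/2`, then `w⁻¹·X·w⁻¹ + w⁻¹` has the same
law as `X`. -/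
theorem stmt_10 (r : ℕ) (hr : 1 ≤ r) (p : ℝ) (hp : (r - 1 : ℝ) / 2 < p)
    (μH : Measure (symSubmodule r)) [μH.IsAddHaarMeasure]
    {Ω : Type*} [MeasurableSpace Ω] (Pr : Measure Ω) [IsProbabilityMeasure Pr]
    (X W : Ω → symSubmodule r) (hX : Measurable X) (hW : Measurable W)
    (hindep : IndepFun X W Pr)
    (hXpos : ∀ᵐ ω ∂Pr, ((X ω : Matrix (Fin r) (Fin r) ℝ)).PosDef)
    (hXlaw : Measure.map (fun ω => symInv r (X ω)) Pr = wishart r μH p)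
    (hWlaw : Measure.map W Pr = gigMatrix r μH p) :
    Measure.map (fun ω => quadInvAdd r (W ω) (X ω)) Pr = Measure.map X Pr := by
  have hinv := measurable_symInv r
  have hprobY := Measure.isProbabilityMeasure_map (μ := Pr) (hinv.comp hX).aemeasurable
  have hprobW := Measure.isProbabilityMeasure_map (μ := Pr) hW.aemeasurable
  rw [show Measure.map (symInv r ∘ X) Pr = wishart r μH p from hXlaw] at hprobY
  rw [hWlaw] at hprobW
  have hWpos : ∀ᵐ ω ∂Pr, (W ω : Matrix (Fin r) (Fin r) ℝ).PosDef := by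
    refine ae_of_ae_map (p := fun w : symSubmodule r =>
      (w : Matrix (Fin r) (Fin r) ℝ).PosDef) hW.aemeasurable ?_
    rw [hWlaw]
    exact posDef_ae_gigMatrix r p μH
  have hT : Measurable fun z : symSubmodule r × symSubmodule r =>
      z.1 - symInv r (symInv r z.1 + z.2) := by fun_prop
  have hpair : Measurable fun ω => (W ω, symInv r (X ω)) := by fun_prop
  have hjoint : Measure.map (fun ω => (W ω, symInv r (X ω))) Pr =
      (gigMatrix r μH p).prod (wishart r μH p) := by
    have h := (indepFun_iff_map_prod_eq_prod_map_map hW.aemeasurable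
      (hinv.comp hX).aemeasurable).1 (hindep.symm.comp measurable_id hinv)
    rw [hWlaw, show Measure.map (symInv r ∘ X) Pr = wishart r μH p from hXlaw] at h
    exact h
  have hlaw : Measure.map (fun ω => W ω - symInv r (symInv r (W ω) + symInv r (X ω))) Pr =
      Measure.map (fun ω => symInv r (X ω)) Pr := by
    rw [hXlaw, ← map_gigMatrix_prod_wishart r p μH, ← hjoint, Measure.map_map hT hpair]
    rfl
  have hZ : (fun ω => quadInvAdd r (W ω) (X ω)) =ᵐ[Pr]
      symInv r ∘ fun ω => W ω - symInv r (symInv r (W ω) + symInv r (X ω)) := by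
    filter_upwards [hXpos, hWpos] with ω hx hw
    rw [Function.comp_apply, ← symInv_quadInvAdd r hw hx,
      symInv_symInv r (quadInvAdd_posDef r hw hx)]
  have hXX : X =ᵐ[Pr] symInv r ∘ fun ω => symInv r (X ω) := by
    filter_upwards [hXpos] with ω hx
    rw [Function.comp_apply, symInv_symInv r hx]
  rw [Measure.map_congr hZ, Measure.map_congr hXX, ← Measure.map_map hinv (by fun_prop),
    ← Measure.map_map hinv (by fun_prop), hlaw]
end
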